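/- arXiv:0709.4492 — 3 statements merged into one kernel-verified Lean document; each statement's English description precedes it below -/
import Mathlib

section
/- Let α ≥ 1 and b > 0, and let f : [0, b] → ℝ be defined by f(x) = x^α. Then for every ε ∈ (0, b^α), inf{ |x − y| : x, y ∈ [0, b], |f(x) − f(y)| ≥ ε } = b − (b^α − ε)^{1/α}. -/
/-- For a convex function, increments over intervals of a fixed length are largest at the right
end of the domain. -/
theorem ConvexOn.sub_le_sub_right_end {s : Set ℝ} {f : ℝ → ℝ} (hf : ConvexOn ℝ s f)
    {x y b : ℝ} (hy : y ∈ s) (hb : b ∈ s) (hyx : y ≤ x) (hxb : x ≤ b) :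
    f x - f y ≤ f b - f (b - (x - y)) := by
  rcases (hyx.trans hxb).eq_or_lt with rfl | hyb
  · obtain rfl := le_antisymm hyx hxb
    simp
  have hpos : 0 < b - y := sub_pos.2 hyb
  have hl : 0 ≤ (b - x) / (b - y) := div_nonneg (sub_nonneg.2 hxb) hpos.le
  have hr : 0 ≤ (x - y) / (b - y) := div_nonneg (sub_nonneg.2 hyx) hpos.le
  have hsum : (b - x) / (b - y) + (x - y) / (b - y) = 1 := by field_simp; ring
  have h₁ := hf.2 hy hb hl hr hsum
  have h₂ := hf.2 hb hy hl hr hsum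
  simp only [smul_eq_mul] at h₁ h₂
  have e₁ : (b - x) / (b - y) * y + (x - y) / (b - y) * b = x := by field_simp; ring
  have e₂ : (b - x) / (b - y) * b + (x - y) / (b - y) * y = b - (x - y) := by field_simp; ring
  rw [e₁] at h₁
  rw [e₂] at h₂
  linear_combination h₁ + h₂ + (f y + f b) * hsum

/-- If `x ^ α` and `y ^ α` differ by at least `ε`, where `0 ≤ y ≤ x ≤ b`, then `x` and `y` are at
least as far apart as `b` and the point where the power is `b ^ α - ε`. -/
theorem sub_rpow_inv_le_sub_of_le_rpow_sub {α b ε x y : ℝ} (hα : 1 ≤ α) (hεM : ε < b ^ α)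
    (hy : 0 ≤ y) (hyx : y ≤ x) (hxb : x ≤ b) (h : ε ≤ x ^ α - y ^ α) :
    b - (b ^ α - ε) ^ (1 / α) ≤ x - y := by
  have hconv := (convexOn_rpow hα).sub_le_sub_right_end (Set.mem_Ici.2 hy)
    (Set.mem_Ici.2 (hy.trans (hyx.trans hxb))) hyx hxb
  have hz : b - (x - y) ≤ (b ^ α - ε) ^ α⁻¹ :=
    (Real.le_rpow_inv_iff_of_pos (by linarith) (by linarith) (by linarith)).2 (by linarith)
  rw [one_div]
  linarith

/-- for `α ≥ 1`, `b > 0`, `f x = x ^ α` on `[0, b]` and `ε ∈ (0, b ^ α)`,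
the optimal delta is `inf { |x - y| : |x^α - y^α| ≥ ε } = b - (b ^ α - ε) ^ (1/α)`. -/
theorem optimal_delta_rpow_of_one_le
    (α b : ℝ) (hα : 1 ≤ α) (hb : 0 < b)
    (ε : ℝ) (hε : 0 < ε) (hεM : ε < b ^ α) :
    sInf {d : ℝ | ∃ x ∈ Set.Icc (0 : ℝ) b, ∃ y ∈ Set.Icc (0 : ℝ) b,
        d = |x - y| ∧ ε ≤ |x ^ α - y ^ α|} = b - (b ^ α - ε) ^ (1 / α) := by
  have hα₀ : 0 < α := by linarith
  have hc₀ : 0 ≤ (b ^ α - ε) ^ (1 / α) := Real.rpow_nonneg (by linarith) _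
  have hcb : (b ^ α - ε) ^ (1 / α) ≤ b := by
    rw [one_div]
    exact (Real.rpow_inv_le_iff_of_pos (by linarith) hb.le hα₀).2 (by linarith)
  have hcα : ((b ^ α - ε) ^ (1 / α)) ^ α = b ^ α - ε := by
    rw [one_div, Real.rpow_inv_rpow (by linarith) hα₀.ne']
  refine IsLeast.csInf_eq ⟨⟨b, ⟨hb.le, le_rfl⟩, _, ⟨hc₀, hcb⟩, ?_, ?_⟩, ?_⟩
  · rw [abs_of_nonneg (sub_nonneg.2 hcb)]
  · rw [hcα, sub_sub_cancel]
    exact le_abs_self ε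
  · rintro d ⟨x, hx, y, hy, rfl, h⟩
    rcases le_total y x with hyx | hxy
    · rw [abs_of_nonneg (sub_nonneg.2 (Real.rpow_le_rpow hy.1 hyx hα₀.le))] at h
      rw [abs_of_nonneg (sub_nonneg.2 hyx)]
      exact sub_rpow_inv_le_sub_of_le_rpow_sub hα hεM hy.1 hyx hx.2 h
    · rw [abs_sub_comm, abs_of_nonneg (sub_nonneg.2 (Real.rpow_le_rpow hx.1 hxy hα₀.le))] at h
      rw [abs_sub_comm, abs_of_nonneg (sub_nonneg.2 hxy)]
      exact sub_rpow_inv_le_sub_of_le_rpow_sub hα hεM hx.1 hxy hy.2 h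
end

section
/- Let 0 < α ≤ 1 and b > 0, and let f : [0, b] → ℝ be defined by f(x) = x^α. Then for every ε ∈ (0, b^α), inf{ |x − y| : x, y ∈ [0, b], |f(x) − f(y)| ≥ ε } = ε^{1/α}. -/
/-- For `0 ≤ α ≤ 1`, the map `x ↦ x ^ α` is `α`-Hölder on `[0, ∞)` with constant `1`. -/
theorem abs_rpow_sub_rpow_le_abs_sub_rpow {α x y : ℝ} (hα0 : 0 ≤ α) (hα1 : α ≤ 1)
    (hx : 0 ≤ x) (hy : 0 ≤ y) : |x ^ α - y ^ α| ≤ |x - y| ^ α := by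
  wlog hyx : y ≤ x generalizing x y
  · rw [abs_sub_comm, abs_sub_comm x y]
    exact this hy hx (le_of_not_ge hyx)
  have hsub : 0 ≤ x - y := sub_nonneg.2 hyx
  have hadd : (x - y + y) ^ α ≤ (x - y) ^ α + y ^ α :=
    Real.rpow_add_le_add_rpow hsub hy hα0 hα1
  rw [sub_add_cancel] at hadd
  rw [abs_of_nonneg hsub, abs_of_nonneg (sub_nonneg.2 (Real.rpow_le_rpow hy hyx hα0))]
  linarith

/-- for `0 < α ≤ 1`, `b > 0`, `f x = x ^ α` on `[0, b]` and `ε ∈ (0, b ^ α)`,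
the optimal delta is `inf { |x - y| : |x^α - y^α| ≥ ε } = ε ^ (1/α)`. -/
theorem optimal_delta_rpow_of_le_one
    (α b : ℝ) (hα0 : 0 < α) (hα1 : α ≤ 1) (hb : 0 < b)
    (ε : ℝ) (hε : 0 < ε) (hεM : ε < b ^ α) :
    sInf {d : ℝ | ∃ x ∈ Set.Icc (0 : ℝ) b, ∃ y ∈ Set.Icc (0 : ℝ) b,
        d = |x - y| ∧ ε ≤ |x ^ α - y ^ α|} = ε ^ (1 / α) := by
  rw [one_div]
  have hδ : 0 ≤ ε ^ α⁻¹ := Real.rpow_nonneg hε.le _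
  refine IsLeast.csInf_eq ⟨⟨ε ^ α⁻¹, ⟨hδ, ?_⟩, 0, ⟨le_rfl, hb.le⟩, ?_, ?_⟩, ?_⟩
  · exact (Real.rpow_inv_le_iff_of_pos hε.le hb.le hα0).2 hεM.le
  · rw [sub_zero, abs_of_nonneg hδ]
  · rw [Real.rpow_inv_rpow hε.le hα0.ne', Real.zero_rpow hα0.ne', sub_zero]
    exact le_abs_self ε
  · rintro d ⟨x, hx, y, hy, rfl, hxy⟩
    exact (Real.rpow_inv_le_iff_of_pos hε.le (abs_nonneg _) hα0).2
      (hxy.trans (abs_rpow_sub_rpow_le_abs_sub_rpow hα0.le hα1 hx.1 hy.1))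
end

section
/- Define f : ℝ → ℝ by f(x) = x if x is irrational, f(1/n) = 1 for every positive integer n, and f(x) = 2x if x is rational and not of the form 1/n for a positive integer n. Then f⁻¹((0, ∞)) and f⁻¹((−∞, 0)) are open subsets of ℝ, yet f is discontinuous at every point of ℝ. -/
open Filter Topology in
/-- A function which is continuous at `x` and vanishes on a dense set vanishes at `x`. -/
theorem ContinuousAt.eq_zero_of_dense {h : ℝ → ℝ} {x : ℝ} {s : Set ℝ}
    (hc : ContinuousAt h x) (hs : Dense s) (h0 : ∀ y ∈ s, h y = 0) : h x = 0 := by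
  have : (𝓝[s] x).NeBot := mem_closure_iff_nhdsWithin_neBot.1 (hs x)
  refine tendsto_nhds_unique (hc.tendsto.mono_left (nhdsWithin_le_nhds (s := s))) ?_
  refine tendsto_const_nhds.congr' ?_
  filter_upwards [self_mem_nhdsWithin] with y hy using (h0 y hy).symm

/-- the function `f : ℝ → ℝ` with `f x = x` for irrational `x`,
`f (1/n) = 1` for positive integers `n`, and `f x = 2x` for all other rational `x`,
has `f ⁻¹' (0, ∞)` and `f ⁻¹' (-∞, 0)` open, yet is discontinuous at every point. -/
theorem preimages_open_yet_nowhere_continuous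
    (f : ℝ → ℝ)
    (hf1 : ∀ x : ℝ, Irrational x → f x = x)
    (hf2 : ∀ n : ℕ, 0 < n → f (1 / (n : ℝ)) = 1)
    (hf3 : ∀ x : ℝ, ¬ Irrational x → (¬ ∃ n : ℕ, 0 < n ∧ x = 1 / (n : ℝ)) → f x = 2 * x) :
    IsOpen (f ⁻¹' Set.Ioi (0 : ℝ)) ∧ IsOpen (f ⁻¹' Set.Iio (0 : ℝ)) ∧
      ∀ x : ℝ, ¬ ContinuousAt f x := by
  have rat_f : ∀ q : ℚ, (f q = 1 ∧ (0 : ℝ) < q ∧ (q : ℝ) ≤ 1) ∨ f q = 2 * q := by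
    intro q
    by_cases hn : ∃ n : ℕ, 0 < n ∧ (q : ℝ) = 1 / (n : ℝ)
    · obtain ⟨n, hn, hq⟩ := hn
      have h1 : (1 : ℝ) ≤ n := by exact_mod_cast hn
      rw [hq]
      exact Or.inl ⟨hf2 n hn, by positivity, (div_le_one (by linarith)).2 h1⟩
    · exact Or.inr (hf3 q (Rat.not_irrational q) hn)
  have cases_f : ∀ x : ℝ, f x = x ∨ (f x = 1 ∧ 0 < x ∧ x ≤ 1) ∨ f x = 2 * x := by
    intro x
    by_cases hx : Irrational x
    · exact Or.inl (hf1 x hx)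
    · obtain ⟨q, rfl⟩ := not_not.1 hx
      exact Or.inr (rat_f q)
  have hpos : f ⁻¹' Set.Ioi (0 : ℝ) = Set.Ioi 0 := by
    ext x
    simp only [Set.mem_preimage, Set.mem_Ioi]
    rcases cases_f x with h | ⟨h, h', -⟩ | h <;> constructor <;> intro <;> linarith
  have hneg : f ⁻¹' Set.Iio (0 : ℝ) = Set.Iio 0 := by
    ext x
    simp only [Set.mem_preimage, Set.mem_Iio]
    rcases cases_f x with h | ⟨h, h', -⟩ | h <;> constructor <;> intro <;> linarith
  refine ⟨by rw [hpos]; exact isOpen_Ioi, by rw [hneg]; exact isOpen_Iio, fun x hc => ?_⟩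
  have hfx : f x = x := by
    have := ContinuousAt.eq_zero_of_dense (h := fun y => f y - y) (hc.sub continuousAt_id)
      dense_irrational fun y hy => sub_eq_zero.2 (hf1 y hy)
    linarith
  have hprod : (f x - 1) * (f x - 2 * x) = 0 := by
    refine ContinuousAt.eq_zero_of_dense (h := fun y => (f y - 1) * (f y - 2 * y))
      (by fun_prop) (Rat.denseRange_cast (𝕜 := ℝ)) ?_
    rintro _ ⟨q, rfl⟩
    rcases rat_f q with h | h <;> simp [h]
  rcases mul_eq_zero.1 hprod with h | h
  · obtain rfl : x = 1 := by linarith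
    obtain ⟨ε, hε, hball⟩ := Metric.continuousAt_iff.1 hc 1 one_pos
    obtain ⟨q, hq1, hq2⟩ := exists_rat_btwn (show (1 : ℝ) < 1 + ε by linarith)
    have hd := hball (x := (q : ℝ)) (by rw [Real.dist_eq, abs_lt]; constructor <;> linarith)
    rw [Real.dist_eq, abs_lt, hfx] at hd
    rcases rat_f q with ⟨-, -, h'⟩ | h' <;> linarith [hd.2]
  · obtain rfl : x = 0 := by linarith
    have hlim := hc.tendsto.comp (tendsto_one_div_add_atTop_nhds_zero_nat (𝕜 := ℝ))
    have hone : f ∘ (fun n : ℕ => 1 / ((n : ℝ) + 1)) = fun _ => 1 := by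
      funext n
      simpa using hf2 (n + 1) n.succ_pos
    rw [hone, hfx] at hlim
    exact one_ne_zero (tendsto_nhds_unique tendsto_const_nhds hlim)
end
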